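/- Let b ≥ 3 be an integer and let p_{n,k} be the number of f-legal k-element subsets of {0, 1, …, bn − 1}, where f(n) = max(1, n mod b). Let μ_n = (∑_k k·p_{n,k})/(∑_k p_{n,k}) and σ_n² = (∑_k k²·p_{n,k})/(∑_k p_{n,k}) − μ_n² be the mean and variance of the number of summands of a uniformly random integer in [0, a(bn)). Then there exists a constant C (depending only on b) such that for all n ≥ 1, | σ_n² − (b² + b − 4)·n / (b² + 2b − 3)^{3/2} | ≤ C. -/

import Mathlib

open Finset

/-- A finite set of indices `S` is `f`-legal. -/
def FLegal (f : ℕ → ℕ) (S : Finset ℕ) : Prop :=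
  ∀ i ∈ S, ∀ j ∈ S, j < i → f i < i - j

instance (f : ℕ → ℕ) (S : Finset ℕ) : Decidable (FLegal f S) := by
  unfold FLegal; infer_instance

/-- `pCount b n k`: the number of `f`-legal `k`-element subsets of `{0, …, b*n − 1}`,
where `f m = max 1 (m % b)`. -/
def pCount (b n k : ℕ) : ℕ :=
  (((Finset.range (b * n)).powersetCard k).filter
    (fun S => FLegal (fun m => max 1 (m % b)) S)).card

/-- The weighted count of the `f`-legal subsets of `range m`, a set `S` having weight `w #S`. -/
def legalSum (f : ℕ → ℕ) (m : ℕ) (w : ℕ → ℝ) : ℝ :=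
  ∑ S ∈ (range m).powerset, if FLegal f S then w S.card else 0

theorem legalSum_zero (f : ℕ → ℕ) (w : ℕ → ℝ) : legalSum f 0 w = w 0 := by
  simp [legalSum, FLegal]

theorem fLegal_insert_iff (f : ℕ → ℕ) {m : ℕ} {S : Finset ℕ} (hS : S ⊆ range m) :
    FLegal f (insert m S) ↔ S ⊆ range (m - f m) ∧ FLegal f S := by
  have hlt : ∀ j ∈ S, j < m := fun j hj => mem_range.1 (hS hj)
  constructor
  · intro h
    refine ⟨fun j hj => ?_, fun i hi j hj => h i (mem_insert_of_mem hi) j (mem_insert_of_mem hj)⟩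
    have := h m (mem_insert_self m S) j (mem_insert_of_mem hj) (hlt j hj)
    rw [mem_range]
    omega
  · rintro ⟨hsub, h⟩ i hi j hj hji
    rcases mem_insert.1 hi with rfl | hiS
    · rcases mem_insert.1 hj with rfl | hjS
      · omega
      · have := mem_range.1 (hsub hjS)
        omega
    · rcases mem_insert.1 hj with rfl | hjS
      · have := hlt i hiS
        omega
      · exact h i hiS j hjS hji

theorem legalSum_succ (f : ℕ → ℕ) (m : ℕ) (w : ℕ → ℝ) :
    legalSum f (m + 1) w = legalSum f m w + legalSum f (m - f m) (fun k => w (k + 1)) := by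
  unfold legalSum
  rw [range_add_one, sum_powerset_insert notMem_range_self]
  congr 1
  have hsub : (range (m - f m)).powerset ⊆ (range m).powerset :=
    powerset_mono.2 (range_subset_range.2 (Nat.sub_le _ _))
  rw [← sum_subset hsub]
  · refine sum_congr rfl fun S hS => ?_
    have hSm := mem_powerset.1 (hsub hS)
    have hc : (insert m S).card = S.card + 1 :=
      card_insert_of_notMem fun h => notMem_range_self (hSm h)
    simp [fLegal_insert_iff f hSm, mem_powerset.1 hS, hc]
  · intro S hS hS'
    rw [if_neg]
    rw [fLegal_insert_iff f (mem_powerset.1 hS)]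
    exact fun h => hS' (mem_powerset.2 h.1)

theorem sum_mul_pCount (b n : ℕ) (w : ℕ → ℝ) :
    ∑ k ∈ range (b * n + 1), w k * (pCount b n k : ℝ) =
      legalSum (fun m => max 1 (m % b)) (b * n) w := by
  have h := sum_powerset (range (b * n))
    (fun S => if FLegal (fun m => max 1 (m % b)) S then w S.card else 0)
  rw [card_range] at h
  rw [legalSum, h]
  refine sum_congr rfl fun k _ => ?_
  rw [← sum_filter, pCount, sum_congr rfl (g := fun _ => w k)]
  · rw [sum_const, nsmul_eq_mul, mul_comm]
  · intro S hS
    rw [(mem_powersetCard.1 (mem_filter.1 hS).1).2]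

theorem legalSum_mod_succ {b n r : ℕ} (hr : r + 1 < b) (w : ℕ → ℝ) :
    legalSum (fun m => max 1 (m % b)) (b * n + (r + 1) + 1) w =
      legalSum (fun m => max 1 (m % b)) (b * n + (r + 1)) w +
        legalSum (fun m => max 1 (m % b)) (b * n) (fun k => w (k + 1)) := by
  have hmod : (b * n + (r + 1)) % b = r + 1 := by
    rw [Nat.mul_add_mod, Nat.mod_eq_of_lt hr]
  have hs : b * n + (r + 1) - max 1 ((b * n + (r + 1)) % b) = b * n := by
    rw [hmod]; omega
  rw [legalSum_succ, hs]

theorem legalSum_mod_add {b n r : ℕ} (hr : r + 1 ≤ b) (w : ℕ → ℝ) :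
    legalSum (fun m => max 1 (m % b)) (b * n + (r + 1)) w =
      legalSum (fun m => max 1 (m % b)) (b * n) w +
        legalSum (fun m => max 1 (m % b)) (b * n - 1) (fun k => w (k + 1)) +
        r * legalSum (fun m => max 1 (m % b)) (b * n) (fun k => w (k + 1)) := by
  induction r with
  | zero =>
    rw [zero_add, legalSum_succ]
    simp
  | succ r ih =>
    rw [show b * n + (r + 1 + 1) = b * n + (r + 1) + 1 by ring, legalSum_mod_succ (by omega),
      ih (by omega)]
    push_cast
    ring

theorem legalSum_mod_one {b : ℕ} (hb : 3 ≤ b) (w : ℕ → ℝ) :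
    legalSum (fun m => max 1 (m % b)) (b * 1) w = w 0 + b * w 1 := by
  obtain ⟨r, rfl⟩ : ∃ r, b = r + 1 := ⟨b - 1, by omega⟩
  have h := legalSum_mod_add (b := r + 1) (n := 0) (r := r) le_rfl w
  simp only [mul_zero, zero_add, Nat.zero_sub, legalSum_zero] at h
  rw [mul_one, h]
  push_cast
  ring

theorem legalSum_mod_rec {b : ℕ} (hb : 3 ≤ b) (n : ℕ) (w : ℕ → ℝ) :
    legalSum (fun m => max 1 (m % b)) (b * (n + 2)) w =
      legalSum (fun m => max 1 (m % b)) (b * (n + 1)) w +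
        b * legalSum (fun m => max 1 (m % b)) (b * (n + 1)) (fun k => w (k + 1)) -
        legalSum (fun m => max 1 (m % b)) (b * n) (fun k => w (k + 2)) := by
  obtain ⟨r, rfl⟩ : ∃ r, b = r + 2 := ⟨b - 2, by omega⟩
  have h1 := legalSum_mod_add (b := r + 2) (n := n + 1) (r := r + 1) le_rfl w
  have h2 := legalSum_mod_succ (b := r + 2) (n := n) (r := r) (by omega) (fun k => w (k + 1))
  rw [show (r + 2) * n + (r + 1) + 1 = (r + 2) * (n + 1) by ring] at h2
  rw [show (r + 2) * (n + 1) + (r + 1 + 1) = (r + 2) * (n + 2) by ring,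
    show (r + 2) * (n + 1) - 1 = (r + 2) * n + (r + 1) by
      rw [Nat.mul_add]; omega] at h1
  rw [h1, h2]
  push_cast
  ring

theorem legalSum_add (f : ℕ → ℕ) (m : ℕ) (v w : ℕ → ℝ) :
    legalSum f m (fun k => v k + w k) = legalSum f m v + legalSum f m w := by
  unfold legalSum
  rw [← sum_add_distrib]
  exact sum_congr rfl fun S _ => by split_ifs <;> simp

theorem legalSum_const_mul (f : ℕ → ℕ) (m : ℕ) (a : ℝ) (w : ℕ → ℝ) :
    legalSum f m (fun k => a * w k) = a * legalSum f m w := by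
  unfold legalSum
  rw [mul_sum]
  exact sum_congr rfl fun S _ => by split_ifs <;> simp

theorem legalSum_natCast_add (f : ℕ → ℕ) (m a : ℕ) :
    legalSum f m (fun k => ((k + a : ℕ) : ℝ)) =
      legalSum f m (fun k => (k : ℝ)) + a * legalSum f m (fun _ => 1) := by
  rw [← legalSum_const_mul, ← legalSum_add]
  simp

theorem legalSum_natCast_add_sq (f : ℕ → ℕ) (m a : ℕ) :
    legalSum f m (fun k => ((k + a : ℕ) : ℝ) ^ 2) =
      legalSum f m (fun k => (k : ℝ) ^ 2) + 2 * a * legalSum f m (fun k => (k : ℝ)) +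
        a ^ 2 * legalSum f m (fun _ => 1) := by
  rw [← legalSum_const_mul, ← legalSum_const_mul, ← legalSum_add, ← legalSum_add]
  congr 1
  ext k
  push_cast
  ring

/-- The pair `(2 sinh ((n + 1) θ), 2 cosh ((n + 1) θ))`, where `(d, e) = (2 sinh θ, 2 cosh θ)`. -/
noncomputable def sinhCosh (d e : ℝ) : ℕ → ℝ × ℝ
  | 0 => (d, e)
  | n + 1 => ((e * (sinhCosh d e n).1 + d * (sinhCosh d e n).2) / 2,
      (e * (sinhCosh d e n).2 + d * (sinhCosh d e n).1) / 2)

theorem sinhCosh_pos {d e : ℝ} (hd : 0 < d) (he : 0 < e) (n : ℕ) :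
    0 < (sinhCosh d e n).1 ∧ 0 < (sinhCosh d e n).2 := by
  induction n with
  | zero => exact ⟨hd, he⟩
  | succ n ih =>
    obtain ⟨h1, h2⟩ := ih
    simp only [sinhCosh]
    constructor <;> positivity

theorem sinhCosh_sq {d e : ℝ} (h : e ^ 2 = d ^ 2 + 4) (n : ℕ) :
    (sinhCosh d e n).2 ^ 2 = (sinhCosh d e n).1 ^ 2 + 4 := by
  induction n with
  | zero => exact h
  | succ n ih =>
    simp only [sinhCosh]
    linear_combination ((sinhCosh d e n).2 ^ 2 - (sinhCosh d e n).1 ^ 2) / 4 * h + ih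

theorem le_sinhCosh_fst {d e : ℝ} (hd : 0 < d) (he : 2 ≤ e) (h : e ^ 2 = d ^ 2 + 4) (n : ℕ) :
    d * (n + 1) ≤ (sinhCosh d e n).1 := by
  induction n with
  | zero => simp [sinhCosh]
  | succ n ih =>
    obtain ⟨h1, h2⟩ := sinhCosh_pos hd (by linarith : 0 < e) n
    have hc : 2 ≤ (sinhCosh d e n).2 := by
      nlinarith [sinhCosh_sq h n, sq_nonneg (sinhCosh d e n).1]
    simp only [sinhCosh]
    push_cast
    nlinarith [mul_le_mul_of_nonneg_right he h1.le, mul_le_mul_of_nonneg_left hc hd.le]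

theorem moments_closed_form {d e : ℝ} (h : e ^ 2 = d ^ 2 + 4) {A B C : ℕ → ℝ}
    (hA0 : A 0 = 1) (hA1 : A 1 = e)
    (hA : ∀ n, A (n + 2) = e * A (n + 1) - A n)
    (hB0 : B 0 = 0) (hB1 : B 1 = e - 1)
    (hB : ∀ n, B (n + 2) = e * B (n + 1) - B n + (e - 1) * A (n + 1) - 2 * A n)
    (hC0 : C 0 = 0) (hC1 : C 1 = e - 1)
    (hC : ∀ n, C (n + 2) = e * C (n + 1) - C n + 2 * (e - 1) * B (n + 1) - 4 * B n
      + (e - 1) * A (n + 1) - 4 * A n) (n : ℕ) :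
    A n * d = (sinhCosh d e n).1 ∧
    B n * d ^ 3 = n * (sinhCosh d e n).1 * d ^ 2 - (n + 1) * (sinhCosh d e n).2 * d
      + e * (sinhCosh d e n).1 ∧
    C n * d ^ 5 = n ^ 2 * (sinhCosh d e n).1 * d ^ 4
      - 2 * n * d ^ 3 * (n + 1) * (sinhCosh d e n).2
      + 2 * n * d ^ 2 * e * (sinhCosh d e n).1 + (n + 1) ^ 2 * (sinhCosh d e n).1 * d ^ 2
      - 2 * (n + 1) * (sinhCosh d e n).2 * e * d + e ^ 2 * (sinhCosh d e n).1
      + 4 * (sinhCosh d e n).1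
      + (d ^ 2 - e) * ((n + 1) * (sinhCosh d e n).2 * d - e * (sinhCosh d e n).1) := by
  have hd2 : d ^ 2 = e ^ 2 - 4 := by linarith
  have hd3 : d ^ 3 = d * (e ^ 2 - 4) := by rw [← hd2]; ring
  have hd4 : d ^ 4 = (e ^ 2 - 4) ^ 2 := by rw [← hd2]; ring
  have hd5 : d ^ 5 = d * (e ^ 2 - 4) ^ 2 := by rw [← hd2]; ring
  have hd6 : d ^ 6 = (e ^ 2 - 4) ^ 3 := by rw [← hd2]; ring
  induction n using Nat.twoStepInduction with
  | zero =>
    simp only [sinhCosh, hA0, hB0, hC0]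
    push_cast
    refine ⟨by ring, by ring, ?_⟩
    ring_nf
    simp only [hd3]
    ring
  | one =>
    simp only [sinhCosh, hA1, hB1, hC1]
    push_cast
    refine ⟨by ring, ?_, ?_⟩
    · ring_nf
    · ring_nf
      simp only [hd3, hd5]
      ring
  | more n ih0 ih1 =>
    obtain ⟨a0, b0, c0⟩ := ih0
    obtain ⟨a1, b1, c1⟩ := ih1
    simp only [sinhCosh] at a1 b1 c1 ⊢
    set s := (sinhCosh d e n).1
    set c := (sinhCosh d e n).2
    rw [hA, hB, hC]
    push_cast at a1 b1 c1 ⊢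
    refine ⟨?_, ?_, ?_⟩
    · refine Eq.trans (b := e * (A (n + 1) * d) - A n * d) (by ring) ?_
      rw [a0, a1]
      ring_nf
      simp only [hd2]
      ring
    · refine Eq.trans (b := e * (B (n + 1) * d ^ 3) - B n * d ^ 3
        + (e - 1) * d ^ 2 * (A (n + 1) * d) - 2 * d ^ 2 * (A n * d)) (by ring) ?_
      rw [a0, a1, b0, b1]
      ring_nf
      simp only [hd2, hd3, hd4]
      ring
    · refine Eq.trans (b := e * (C (n + 1) * d ^ 5) - C n * d ^ 5
        + 2 * (e - 1) * d ^ 2 * (B (n + 1) * d ^ 3) - 4 * d ^ 2 * (B n * d ^ 3)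
        + (e - 1) * d ^ 4 * (A (n + 1) * d) - 4 * d ^ 4 * (A n * d)) (by ring) ?_
      rw [a0, a1, b0, b1, c0, c1]
      ring_nf
      simp only [hd2, hd3, hd4, hd5, hd6]
      ring

theorem variance_closed_form {d e s c A B C N : ℝ} (hd : 0 < d) (hs : 0 < s)
    (hsc : c ^ 2 = s ^ 2 + 4) (hA : A * d = s)
    (hB : B * d ^ 3 = N * s * d ^ 2 - (N + 1) * c * d + e * s)
    (hC : C * d ^ 5 = N ^ 2 * s * d ^ 4 - 2 * N * d ^ 3 * (N + 1) * c
      + 2 * N * d ^ 2 * e * s + (N + 1) ^ 2 * s * d ^ 2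
      - 2 * (N + 1) * c * e * d + e ^ 2 * s + 4 * s
      + (d ^ 2 - e) * ((N + 1) * c * d - e * s)) :
    C / A - (B / A) ^ 2 =
      (d ^ 2 - e) / d ^ 3 * ((N + 1) * c / s - e / d)
        + (4 / d ^ 2 - 4 * ((N + 1) / s) ^ 2) / d ^ 2 := by
  have hA' : A = s / d := by rw [← hA]; field_simp
  have hB' : B = (N * s * d ^ 2 - (N + 1) * c * d + e * s) / d ^ 3 := by
    rw [← hB]; field_simp
  have hC' := eq_div_of_mul_eq (pow_pos hd 5).ne' hC
  rw [hA', hB', hC']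
  field_simp
  linear_combination (-(N + 1) ^ 2 * d ^ 2) * hsc

theorem variance_bound {d e s c N : ℝ} (hd : 0 < d) (he : 0 < e) (hN : 0 ≤ N) (hc : 0 < c)
    (hs : d * (N + 1) ≤ s) (hsc : c ^ 2 = s ^ 2 + 4) :
    |(d ^ 2 - e) / d ^ 3 * ((N + 1) * c / s - e / d)
        + (4 / d ^ 2 - 4 * ((N + 1) / s) ^ 2) / d ^ 2 - (d ^ 2 - e) / d ^ 3 * N| ≤
      |(d ^ 2 - e) / d ^ 3| * (2 / d + 1 + e / d) + 4 / d ^ 2 / d ^ 2 := by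
  have hs0 : 0 < s := lt_of_lt_of_le (by positivity) hs
  have hq : (N + 1) / s ≤ 1 / d := by
    rw [div_le_div_iff₀ hs0 hd]; linarith
  have hq0 : 0 ≤ (N + 1) / s := by positivity
  have hcs : 0 ≤ c - s := by nlinarith
  have hcs2 : c - s ≤ 2 := by nlinarith
  have hsplit : (d ^ 2 - e) / d ^ 3 * ((N + 1) * c / s - e / d)
        + (4 / d ^ 2 - 4 * ((N + 1) / s) ^ 2) / d ^ 2 - (d ^ 2 - e) / d ^ 3 * N =
      (d ^ 2 - e) / d ^ 3 * ((N + 1) / s * (c - s) + 1 - e / d)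
        + (4 / d ^ 2 - 4 * ((N + 1) / s) ^ 2) / d ^ 2 := by
    field_simp
    ring
  rw [hsplit]
  refine (abs_add_le _ _).trans (add_le_add ?_ ?_)
  · rw [abs_mul]
    refine mul_le_mul_of_nonneg_left ?_ (abs_nonneg _)
    have h1 : (N + 1) / s * (c - s) ≤ 1 / d * 2 := mul_le_mul hq hcs2 hcs (by positivity)
    have h2 : 0 ≤ (N + 1) / s * (c - s) := mul_nonneg hq0 hcs
    have h3 : 0 < e / d := by positivity
    have h4 : 1 / d * 2 = 2 / d := by ring
    rw [abs_le]
    constructor <;> linarith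
  · have h1 : ((N + 1) / s) ^ 2 ≤ (1 / d) ^ 2 := pow_le_pow_left₀ hq0 hq 2
    have h2 : 4 / d ^ 2 = 4 * (1 / d) ^ 2 := by ring
    have h3 := sq_nonneg ((N + 1) / s)
    rw [abs_of_nonneg (div_nonneg (by linarith) (by positivity))]
    gcongr
    linarith

theorem stmt13 (b : ℕ) (hb : 3 ≤ b)
    (μ : ℕ → ℝ)
    (hμ : ∀ n, μ n = (∑ k ∈ range (b * n + 1), (k : ℝ) * (pCount b n k : ℝ)) /
      (∑ k ∈ range (b * n + 1), (pCount b n k : ℝ)))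
    (σsq : ℕ → ℝ)
    (hσsq : ∀ n, σsq n =
      (∑ k ∈ range (b * n + 1), (k : ℝ) ^ 2 * (pCount b n k : ℝ)) /
        (∑ k ∈ range (b * n + 1), (pCount b n k : ℝ)) - (μ n) ^ 2) :
    ∃ C : ℝ, ∀ n : ℕ, 1 ≤ n →
      |σsq n - ((b : ℝ) ^ 2 + b - 4) * n / ((b : ℝ) ^ 2 + 2 * b - 3) ^ ((3 : ℝ) / 2)| ≤ C := by
  have hb' : (3 : ℝ) ≤ b := by exact_mod_cast hb
  obtain ⟨e, he⟩ : ∃ e : ℝ, e = b + 1 := ⟨_, rfl⟩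
  have hD : 0 < (b : ℝ) ^ 2 + 2 * b - 3 := by nlinarith
  obtain ⟨d, hd⟩ : ∃ d : ℝ, d = √((b : ℝ) ^ 2 + 2 * b - 3) := ⟨_, rfl⟩
  have hd0 : 0 < d := hd ▸ Real.sqrt_pos.2 hD
  have hd2 : d ^ 2 = (b : ℝ) ^ 2 + 2 * b - 3 := by rw [hd, Real.sq_sqrt hD.le]
  have hde : e ^ 2 = d ^ 2 + 4 := by rw [hd2, he]; ring
  have hpow : ((b : ℝ) ^ 2 + 2 * b - 3) ^ ((3 : ℝ) / 2) = d ^ 3 := by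
    rw [← hd2, ← Real.rpow_natCast_mul hd0.le, ← Real.rpow_natCast]
    norm_num
  let f : ℕ → ℕ := fun m => max 1 (m % b)
  have hform := moments_closed_form hde
    (A := fun n => legalSum f (b * n) fun _ => 1)
    (B := fun n => legalSum f (b * n) fun k => (k : ℝ))
    (C := fun n => legalSum f (b * n) fun k => (k : ℝ) ^ 2)
    (by simp [legalSum_zero])
    (by simp only [f, legalSum_mod_one hb]; rw [he]; ring)
    (fun n => by simp only [f, legalSum_mod_rec hb]; rw [he]; ring)
    (by simp [legalSum_zero])
    (by simp only [f, legalSum_mod_one hb]; rw [he]; push_cast; ring)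
    (fun n => by
      simp only [f, legalSum_mod_rec hb, legalSum_natCast_add]; rw [he]; push_cast; ring)
    (by simp [legalSum_zero])
    (by simp only [f, legalSum_mod_one hb]; rw [he]; push_cast; ring)
    (fun n => by
      simp only [f, legalSum_mod_rec hb, legalSum_natCast_add_sq]; rw [he]; push_cast; ring)
  refine ⟨|(d ^ 2 - e) / d ^ 3| * (2 / d + 1 + e / d) + 4 / d ^ 2 / d ^ 2, fun n _ => ?_⟩
  have he0 : 0 < e := by linarith
  obtain ⟨hs, hc⟩ := sinhCosh_pos hd0 he0 n
  obtain ⟨hA, hB, hC⟩ := hform n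
  have hsum : ∑ k ∈ range (b * n + 1), (pCount b n k : ℝ) = legalSum f (b * n) fun _ => 1 := by
    simpa using sum_mul_pCount b n fun _ => 1
  rw [hσsq, hμ, hsum, sum_mul_pCount b n fun k => (k : ℝ),
    sum_mul_pCount b n fun k => (k : ℝ) ^ 2,
    variance_closed_form hd0 hs (sinhCosh_sq hde n) hA hB hC, hpow,
    show (b : ℝ) ^ 2 + b - 4 = d ^ 2 - e by rw [hd2, he]; ring,
    mul_div_right_comm (d ^ 2 - e)]
  exact variance_bound hd0 he0 n.cast_nonneg hc
    (le_sinhCosh_fst hd0 (by linarith) hde n) (sinhCosh_sq hde n)
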